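/- arXiv:0812.2366 — 2 statements merged into one kernel-verified Lean document; each statement's English description precedes it below -/
import Mathlib

section
/- Let H be a d-uniform hypergraph with n edges E_1,...,E_n such that every edge of H contains a free vertex. Then for every i, the i-th total Betti number of R/I(H) over R = k[x_v : v a vertex of H] equals the binomial coefficient C(n, i); in particular the Taylor complex on the generators x^{E_1},...,x^{E_n} is a minimal free resolution. -/
open MvPolynomial

/-- A *minimal graded free resolution* of `R ⧸ I`, where `R = k[x_v : v ∈ V]` is the
polynomial ring with its standard grading.  The `i`-th free module is
`⨁_j R(-j)^{β i j}`, encoded as finitely supported functions on `Σ j, Fin (β i j)`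
(the basis element `⟨j, t⟩` having degree `j`).  The graded Betti number
`β_{i,j}(R ⧸ I) = dim_k Tor_i^R(R ⧸ I, k)_j` equals `β i j` for any such resolution. -/
structure MinimalGradedFreeResolution (k V : Type) [Field k] [Fintype V] [DecidableEq V]
    (I : Ideal (MvPolynomial V k)) where
  /-- the ranks: `β i j` copies of `R(-j)` in homological degree `i` -/
  β : ℕ → ℕ → ℕ
  /-- the `0`-th free module is a single copy of `R` generated in degree `0` -/
  β_zero : ∀ j, β 0 j = if j = 0 then 1 else 0
  /-- the differentials -/
  d : ∀ i : ℕ,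
    ((Σ j : ℕ, Fin (β (i + 1) j)) →₀ MvPolynomial V k) →ₗ[MvPolynomial V k]
      ((Σ j : ℕ, Fin (β i j)) →₀ MvPolynomial V k)
  /-- the augmentation onto `R ⧸ I` -/
  aug : ((Σ j : ℕ, Fin (β 0 j)) →₀ MvPolynomial V k) →ₗ[MvPolynomial V k]
      (MvPolynomial V k ⧸ I)
  aug_surjective : Function.Surjective aug
  /-- exactness at homological degree `0` -/
  exact_zero : LinearMap.ker aug = LinearMap.range (d 0)
  /-- exactness at homological degree `i + 1` -/
  exact_succ : ∀ i, LinearMap.ker (d i) = LinearMap.range (d (i + 1))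
  /-- minimality: the image of each differential lies in `m · F`, where `m = (x_v : v ∈ V)` -/
  minimal : ∀ i x p, constantCoeff ((d i x) p) = 0
  /-- the differentials are graded: the image of a degree-`j` basis vector is homogeneous
  of degree `j` -/
  graded : ∀ (i j : ℕ) (t : Fin (β (i + 1) j)) (p : Σ j' : ℕ, Fin (β i j')),
      ((d i (Finsupp.single ⟨j, t⟩ 1)) p).IsHomogeneous (j - p.1) ∧
        (p.1 ≤ j ∨ (d i (Finsupp.single ⟨j, t⟩ 1)) p = 0)

/-- The edge ideal `I(H)` of a hypergraph with edges `E 0, …, E (n-1)`: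
the ideal generated by the squarefree monomials `x^{E i} = ∏_{v ∈ E i} x_v`. -/
noncomputable def edgeIdeal (k : Type) {V : Type} [Field k] [Fintype V] [DecidableEq V]
    {n : ℕ} (E : Fin n → Finset V) : Ideal (MvPolynomial V k) :=
  Ideal.span (Set.range fun i => ∏ v ∈ E i, (X v : MvPolynomial V k))

section TaylorHelpers

open CategoryTheory CategoryTheory.Abelian

universe u

variable {R : Type u} [CommRing R]

/-- The length of the module `Ext^i(M, N)`. -/
noncomputable def extLen (M N : ModuleCat.{u} R) (i : ℕ) : ℕ∞ :=
  Module.length R (Ext M N i)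

/-- Precomposition with a class, as a linear map. -/
noncomputable def preL {X Y : ModuleCat.{u} R} {a : ℕ} (α : Ext X Y a) (N : ModuleCat.{u} R)
    {b c : ℕ} (h : a + b = c) : Ext Y N b →ₗ[R] Ext X N c :=
  Ext.bilinearCompOfLinear R X Y N a b c h α

lemma preL_apply {X Y : ModuleCat.{u} R} {a : ℕ} (α : Ext X Y a) (N : ModuleCat.{u} R)
    {b c : ℕ} (h : a + b = c) (x : Ext Y N b) : preL α N h x = α.comp x h := rfl

/-- If `f` induces zero on `Ext`, the long exact sequence splits into short ones. -/
lemma extLen_succ {S : ShortComplex (ModuleCat.{u} R)} (hS : S.ShortExact)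
    (N : ModuleCat.{u} R)
    (h0 : ∀ (i : ℕ) (x : Ext S.X₂ N i), (Ext.mk₀ S.f).comp x (zero_add i) = 0) (i : ℕ) :
    extLen S.X₃ N (i + 1) = extLen S.X₁ N i + extLen S.X₂ N (i + 1) := by
  refine Module.length_eq_add_of_exact (preL hS.extClass N (add_comm 1 i))
    (preL (Ext.mk₀ S.g) N (zero_add (i + 1))) ?_ ?_ ?_
  · rw [injective_iff_map_eq_zero]
    intro x hx
    obtain ⟨y, rfl⟩ := Ext.contravariant_sequence_exact₁ hS N x (add_comm 1 i) hx
    exact h0 i y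
  · intro x
    exact Ext.contravariant_sequence_exact₂ hS N x (h0 _ x)
  · intro x
    constructor
    · intro hx
      exact Ext.contravariant_sequence_exact₃ hS N x hx (add_comm 1 i)
    · rintro ⟨y, rfl⟩
      simp only [preL_apply]
      exact hS.comp_extClass_assoc y (add_comm 1 i)

lemma extLen_zero {S : ShortComplex (ModuleCat.{u} R)} (hS : S.ShortExact)
    (N : ModuleCat.{u} R)
    (h0 : ∀ (x : Ext S.X₂ N 0), (Ext.mk₀ S.f).comp x (zero_add 0) = 0) :
    extLen S.X₃ N 0 = extLen S.X₂ N 0 := by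
  have := hS.epi_g
  refine (LinearEquiv.ofBijective (preL (Ext.mk₀ S.g) N (zero_add 0)) ⟨?_, ?_⟩).length_eq
  · exact Ext.precomp_mk₀_injective_of_epi N S.g
  · intro x
    exact Ext.contravariant_sequence_exact₂ hS N x (h0 x)

lemma extLen_congr {M M' : Type u} [AddCommGroup M] [Module R M] [AddCommGroup M'] [Module R M']
    (e : M ≃ₗ[R] M') (N : ModuleCat.{u} R) (i : ℕ) :
    extLen (ModuleCat.of R M) N i = extLen (ModuleCat.of R M') N i := by
  have h1 : (ModuleCat.ofHom e.toLinearMap) ≫ (ModuleCat.ofHom e.symm.toLinearMap) = 𝟙 _ := by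
    ext x; simp
  have h2 : (ModuleCat.ofHom e.symm.toLinearMap) ≫ (ModuleCat.ofHom e.toLinearMap) = 𝟙 _ := by
    ext x; simp
  refine (LinearEquiv.ofLinearMap
    (preL (Ext.mk₀ (ModuleCat.ofHom e.symm.toLinearMap)) N (zero_add i))
    (preL (Ext.mk₀ (ModuleCat.ofHom e.toLinearMap)) N (zero_add i)) ?_ ?_).length_eq
  · ext1 x
    simp only [LinearMap.comp_apply, preL_apply, LinearMap.id_apply]
    rw [Ext.mk₀_comp_mk₀_assoc, h2, Ext.mk₀_id_comp]
  · ext1 x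
    simp only [LinearMap.comp_apply, preL_apply, LinearMap.id_apply]
    rw [Ext.mk₀_comp_mk₀_assoc, h1, Ext.mk₀_id_comp]

lemma extLen_free_succ (ι : Type u) (N : ModuleCat.{u} R) (i : ℕ) :
    extLen (ModuleCat.of R (ι →₀ R)) N (i + 1) = 0 := by
  have : Projective (ModuleCat.of R (ι →₀ R)) :=
    ModuleCat.projective_of_free (Finsupp.basisSingleOne)
  have : Subsingleton (Ext (ModuleCat.of R (ι →₀ R)) N (i + 1)) :=
    Ext.subsingleton_of_projective _ _ _
  exact Module.length_eq_zero

lemma extLen_free_zero (ι : Type u) (N : ModuleCat.{u} R) [IsSimpleModule R N] :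
    extLen (ModuleCat.of R (ι →₀ R)) N 0 = ENat.card ι := by
  have e : Ext (ModuleCat.of R (ι →₀ R)) N 0 ≃ₗ[R] (ι → N) :=
    Ext.linearEquiv₀.trans ((ModuleCat.homLinearEquiv (S := R)).trans
      (Finsupp.llift N R R ι).symm)
  rw [extLen, e.length_eq, Module.length_pi, Module.length_eq_one, mul_one]

/-- smul by an annihilator of `N` kills the induced map on `Ext`. -/
lemma comp_smul_eq_zero {X Y N : ModuleCat.{u} R} (f : X ⟶ Y) (r : R)
    (hr : ∀ y : N, r • y = 0) (i : ℕ) (x : Ext Y N i) :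
    (Ext.mk₀ (r • f)).comp x (zero_add i) = 0 := by
  rw [Ext.mk₀_smul, Ext.smul_comp, Ext.smul_eq_comp_mk₀]
  have : r • 𝟙 N = 0 := by
    ext y; exact hr y
  rw [this, Ext.mk₀_zero, Ext.comp_zero]

/-- one-step minimal free cover -/
lemma extLen_cover {ι : Type u} (N : ModuleCat.{u} R) {S : ShortComplex (ModuleCat.{u} R)}
    (hS : S.ShortExact) (hX : S.X₂ = ModuleCat.of R (ι →₀ R))
    (h : ∀ φ : S.X₂ ⟶ N, S.f ≫ φ = 0) (i : ℕ) :
    extLen S.X₃ N (i + 1) = extLen S.X₁ N i ∧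
    extLen S.X₃ N 0 = extLen (ModuleCat.of R (ι →₀ R)) N 0 := by
  have h00 : ∀ (x : Ext S.X₂ N 0), (Ext.mk₀ S.f).comp x (zero_add 0) = 0 := by
    intro x
    obtain ⟨φ, rfl⟩ := Ext.homEquiv₀.symm.surjective x
    simp [h φ]
  have hp (j : ℕ) : Subsingleton (Ext S.X₂ N (j + 1)) := by
    rw [hX]
    exact Module.length_eq_zero_iff.1 (extLen_free_succ ι N j)
  constructor
  · rw [extLen_succ hS N ?_ i, hX, extLen_free_succ, add_zero]
    rintro (_ | j) x
    · exact h00 x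
    · rw [Subsingleton.elim x 0]; simp
  · rw [extLen_zero hS N h00, hX]

lemma shortExact_mk {A B C : Type u} [AddCommGroup A] [Module R A] [AddCommGroup B] [Module R B]
    [AddCommGroup C] [Module R C] (f : A →ₗ[R] B) (p : B →ₗ[R] C)
    (hinj : Function.Injective f) (hex : Function.Exact f p) (hsurj : Function.Surjective p) :
    ∃ w, (ShortComplex.mk (ModuleCat.ofHom f) (ModuleCat.ofHom p) w).ShortExact := by
  refine ⟨?_, ?_⟩
  · ext x
    exact hex.apply_apply_eq_zero x
  · exact
      { exact := (ShortComplex.ShortExact.moduleCat_exact_iff_function_exact _).mpr hex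
        mono_f := (ModuleCat.mono_iff_injective _).2 hinj
        epi_g := (ModuleCat.epi_iff_surjective _).2 hsurj }

lemma extLen_step {A B C : Type u} [AddCommGroup A] [Module R A] [AddCommGroup B] [Module R B]
    [AddCommGroup C] [Module R C] (N : ModuleCat.{u} R) (g : A →ₗ[R] B) (p : B →ₗ[R] C)
    (r : R) (hr : ∀ y : N, r • y = 0)
    (hinj : Function.Injective (r • g)) (hex : Function.Exact (r • g) p)
    (hsurj : Function.Surjective p) :
    extLen (ModuleCat.of R C) N 0 = extLen (ModuleCat.of R B) N 0 ∧
    ∀ i, extLen (ModuleCat.of R C) N (i + 1) =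
      extLen (ModuleCat.of R A) N i + extLen (ModuleCat.of R B) N (i + 1) := by
  obtain ⟨w, hS⟩ := shortExact_mk (r • g) p hinj hex hsurj
  have key : ∀ (i : ℕ) (x : Ext (ModuleCat.of R B) N i),
      (Ext.mk₀ (ModuleCat.ofHom (r • g))).comp x (zero_add i) = 0 :=
    fun i x => comp_smul_eq_zero (ModuleCat.ofHom g) r hr i x
  exact ⟨extLen_zero hS N (key 0), fun i => extLen_succ hS N key i⟩

lemma extLen_cover' {A C ι : Type u} [AddCommGroup A] [Module R A]
    [AddCommGroup C] [Module R C] (N : ModuleCat.{u} R) [IsSimpleModule R N]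
    (f : A →ₗ[R] (ι →₀ R)) (p : (ι →₀ R) →ₗ[R] C)
    (hinj : Function.Injective f) (hex : Function.Exact f p) (hsurj : Function.Surjective p)
    (hm : ∀ a q, ∀ y : N, f a q • y = 0) :
    extLen (ModuleCat.of R C) N 0 = ENat.card ι ∧
    ∀ i, extLen (ModuleCat.of R C) N (i + 1) = extLen (ModuleCat.of R A) N i := by
  obtain ⟨w, hS⟩ := shortExact_mk f p hinj hex hsurj
  have h : ∀ φ : ModuleCat.of R (ι →₀ R) ⟶ N, ModuleCat.ofHom f ≫ φ = 0 := by
    intro φ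
    ext a
    change φ.hom (f a) = 0
    rw [← Finsupp.sum_single (f a), Finsupp.sum, map_sum]
    refine Finset.sum_eq_zero fun q _ => ?_
    rw [← mul_one (f a q), ← smul_eq_mul, ← Finsupp.smul_single, map_smul]
    exact hm a q _
  refine ⟨?_, fun i => (extLen_cover (ι := ι) N hS rfl h i).1⟩
  rw [← extLen_free_zero ι N]
  exact (extLen_cover (ι := ι) N hS rfl h 0).2

end TaylorHelpers

section MonomialHelpers

variable {k V : Type} [Field k] [Fintype V] [DecidableEq V]

/-- The squarefree monomial ideal of a subfamily. -/
noncomputable def famIdeal (k : Type) {V ι : Type} [Field k] (s : Finset ι) (E : ι → Finset V) :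
    Ideal (MvPolynomial V k) :=
  Ideal.span ((fun i => ∏ v ∈ E i, (X v : MvPolynomial V k)) '' (s : Set ι))

/-- Exponent vector of a squarefree monomial. -/
noncomputable def indV {V : Type} (A : Finset V) : V →₀ ℕ := ∑ v ∈ A, Finsupp.single v 1

lemma prod_X_eq (A : Finset V) :
    ∏ v ∈ A, (X v : MvPolynomial V k) = monomial (indV A) 1 := by
  rw [indV, monomial_sum_one]; rfl

lemma indV_apply (A : Finset V) (v : V) : indV A v = if v ∈ A then 1 else 0 := by
  simp [indV, Finsupp.finsetSum_apply, Finsupp.single_apply]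

lemma mem_famIdeal {ι : Type} (s : Finset ι) (E : ι → Finset V) (r : MvPolynomial V k) :
    r ∈ famIdeal k s E ↔ ∀ xi ∈ r.support, ∃ i ∈ s, ∀ v ∈ E i, 1 ≤ xi v := by
  have : famIdeal k s E = Ideal.span ((fun e => monomial e (1 : k)) ''
      ((fun i => indV (E i)) '' (s : Set ι))) := by
    rw [famIdeal, Set.image_image]
    simp only [prod_X_eq]
  rw [this, mem_ideal_span_monomial_image]
  refine forall₂_congr fun xi _ => ?_
  simp only [Set.mem_image, Finset.mem_coe, exists_exists_and_eq_and]
  refine exists_congr fun i => and_congr_right fun _ => ?_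
  rw [Finsupp.le_def]
  refine forall_congr' fun v => ?_
  rw [indV_apply]
  split_ifs with h <;> simp [h]

lemma colon_mem {ι : Type} (s : Finset ι) (E : ι → Finset V) (A : Finset V)
    (r : MvPolynomial V k) (h : (∏ v ∈ A, X v) * r ∈ famIdeal k s E) :
    r ∈ famIdeal k s (fun i => E i \ A) := by
  rw [mem_famIdeal] at h ⊢
  intro xi hxi
  obtain ⟨i, hi, hv⟩ := h (indV A + xi) (by
    rw [prod_X_eq, mem_support_iff, coeff_monomial_mul, one_mul]
    exact mem_support_iff.1 hxi)
  refine ⟨i, hi, fun v hvm => ?_⟩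
  rw [Finset.mem_sdiff] at hvm
  simpa [indV_apply, hvm.2] using hv v hvm.1

lemma mul_mem_famIdeal {ι : Type} (s : Finset ι) (E : ι → Finset V) (A : Finset V)
    (w : V) (hw : ∀ i ∈ s, w ∉ E i)
    (r : MvPolynomial V k) (h : r ∈ famIdeal k s (fun i => E i \ A)) :
    (∏ v ∈ A.erase w, X v) * r ∈ famIdeal k s E := by
  suffices H : famIdeal k s (fun i => E i \ A) ≤
      Submodule.comap (LinearMap.mulLeft (MvPolynomial V k) (∏ v ∈ A.erase w, X v))
        (famIdeal k s E) from H h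
  refine Ideal.span_le.2 ?_
  rintro _ ⟨i, hi, rfl⟩
  change (∏ v ∈ A.erase w, X v) * (∏ v ∈ E i \ A, X v) ∈ famIdeal k s E
  refine Ideal.mem_of_dvd _ ?_ (Ideal.subset_span ⟨i, hi, rfl⟩)
  have hd : Disjoint (A.erase w) (E i \ A) :=
    Finset.disjoint_sdiff.mono_left (Finset.erase_subset _ _)
  dsimp only
  rw [← Finset.prod_union hd]
  refine Finset.prod_dvd_prod_of_subset _ _ _ fun v hv => ?_
  have : v ≠ w := fun h => hw i hi (h ▸ hv)
  simp only [Finset.mem_union, Finset.mem_erase, Finset.mem_sdiff]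
  tauto

/-- The residue field as a module. -/
noncomputable abbrev resN (k V : Type) [Field k] : ModuleCat.{0} (MvPolynomial V k) :=
  ModuleCat.of _ (MvPolynomial V k ⧸ RingHom.ker (constantCoeff (σ := V) (R := k)))

instance resN_simple : IsSimpleModule (MvPolynomial V k) (resN k V) := by
  have : (RingHom.ker (constantCoeff (σ := V) (R := k))).IsMaximal :=
    RingHom.ker_isMaximal_of_surjective _ fun c => ⟨C c, by simp⟩
  exact isSimpleModule_iff_isCoatom.2 (Ideal.isMaximal_def.1 this)

lemma resN_smul (r : MvPolynomial V k) (hr : constantCoeff r = 0) (y : resN k V) : r • y = 0 := by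
  obtain ⟨y, rfl⟩ := Submodule.Quotient.mk_surjective _ y
  rw [← Submodule.Quotient.mk_smul, Submodule.Quotient.mk_eq_zero, smul_eq_mul]
  exact Ideal.mul_mem_right _ _ (by simpa [RingHom.mem_ker] using hr)

lemma extLen_fam {ι : Type} [DecidableEq ι] (s : Finset ι) :
    ∀ E : ι → Finset V, (∀ i ∈ s, ∃ v ∈ E i, ∀ i' ∈ s, v ∈ E i' → i' = i) →
    ∀ j, extLen (ModuleCat.of (MvPolynomial V k) (MvPolynomial V k ⧸ famIdeal k s E))
      (resN k V) j = (s.card.choose j : ℕ∞) := by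
  induction s using Finset.induction_on with
  | empty =>
    intro E _ j
    have hb : famIdeal k ∅ E = ⊥ := by simp [famIdeal]
    let e : (MvPolynomial V k ⧸ famIdeal k ∅ E) ≃ₗ[MvPolynomial V k]
        (Unit →₀ MvPolynomial V k) :=
      (Submodule.quotEquivOfEqBot _ hb).trans (Finsupp.LinearEquiv.finsuppUnique _ _ _).symm
    rw [extLen_congr e]
    cases j with
    | zero => rw [extLen_free_zero]; simp
    | succ j => rw [extLen_free_succ]; simp
  | insert a s ha ih =>
    intro E hE
    obtain ⟨w, hwa, hw⟩ := hE a (Finset.mem_insert_self _ _)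
    have hw' : ∀ i ∈ s, w ∉ E i := fun i hi hwi =>
      ha (hw i (Finset.mem_insert_of_mem hi) hwi ▸ hi)
    have ih1 := ih E fun i hi => by
      obtain ⟨v, hv, h⟩ := hE i (Finset.mem_insert_of_mem hi)
      exact ⟨v, hv, fun i' hi' => h i' (Finset.mem_insert_of_mem hi')⟩
    have ih2 := ih (fun i => E i \ E a) fun i hi => by
      obtain ⟨v, hv, h⟩ := hE i (Finset.mem_insert_of_mem hi)
      refine ⟨v, Finset.mem_sdiff.2 ⟨hv, fun hva => ?_⟩, fun i' hi' hv' =>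
        h i' (Finset.mem_insert_of_mem hi') (Finset.mem_sdiff.1 hv').1⟩
      have := h a (Finset.mem_insert_self _ _) hva
      exact ha (this ▸ hi)
    have hle : famIdeal k s E ≤ famIdeal k (insert a s) E :=
      Ideal.span_mono (Set.image_mono (by simp))
    let g : (MvPolynomial V k ⧸ famIdeal k s (fun i => E i \ E a)) →ₗ[MvPolynomial V k]
        (MvPolynomial V k ⧸ famIdeal k s E) :=
      Submodule.mapQ _ _ (LinearMap.mulLeft (MvPolynomial V k) (∏ v ∈ (E a).erase w, X v))
        fun r hr => mul_mem_famIdeal s E (E a) w hw' r hr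
    let p : (MvPolynomial V k ⧸ famIdeal k s E) →ₗ[MvPolynomial V k]
        (MvPolynomial V k ⧸ famIdeal k (insert a s) E) := Submodule.factor hle
    have hg : ∀ r : MvPolynomial V k, ((X w : MvPolynomial V k) • g) (Submodule.Quotient.mk r) =
        Submodule.Quotient.mk ((∏ v ∈ E a, X v) * r) := by
      intro r
      rw [← Finset.mul_prod_erase _ _ hwa, mul_assoc]
      rfl
    have hp : ∀ r : MvPolynomial V k, p (Submodule.Quotient.mk r) = Submodule.Quotient.mk r :=
      fun r => rfl
    obtain ⟨h0, hs⟩ := extLen_step (resN k V) g p (X w)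
      (resN_smul _ (by simp)) (by
        rw [injective_iff_map_eq_zero]
        intro x hx
        obtain ⟨r, rfl⟩ := Submodule.Quotient.mk_surjective _ x
        rw [hg, Submodule.Quotient.mk_eq_zero] at hx
        rw [Submodule.Quotient.mk_eq_zero]
        exact colon_mem s E (E a) r hx) (by
        intro x
        obtain ⟨r, rfl⟩ := Submodule.Quotient.mk_surjective _ x
        rw [hp, Submodule.Quotient.mk_eq_zero]
        constructor
        · intro hr
          rw [famIdeal, Finset.coe_insert, Set.image_insert_eq, Ideal.mem_span_insert] at hr
          obtain ⟨c, z, hz, rfl⟩ := hr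
          refine ⟨Submodule.Quotient.mk c, ?_⟩
          rw [hg, Submodule.Quotient.eq, mul_comm]
          have : z ∈ famIdeal k s E := hz
          simpa using this
        · rintro ⟨y, hy⟩
          obtain ⟨c, rfl⟩ := Submodule.Quotient.mk_surjective _ y
          rw [hg, Submodule.Quotient.eq] at hy
          have h1 := hle hy
          have h2 : (∏ v ∈ E a, X v) * c ∈ famIdeal k (insert a s) E :=
            Ideal.mul_mem_right _ _ (Ideal.subset_span ⟨a, by simp, rfl⟩)
          have h3 := sub_mem h2 h1
          simpa using h3) (Submodule.factor_surjective hle)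
    intro j
    rw [Finset.card_insert_of_notMem ha]
    cases j with
    | zero => rw [h0, ih1]; simp
    | succ j => rw [hs, ih1, ih2, Nat.choose_succ_succ]; push_cast; rfl

lemma extLen_resolution {I : Ideal (MvPolynomial V k)} (F : MinimalGradedFreeResolution k V I)
    (i : ℕ) :
    extLen (ModuleCat.of (MvPolynomial V k) (MvPolynomial V k ⧸ I)) (resN k V) i =
      ENat.card (Σ j : ℕ, Fin (F.β i j)) := by
  have key (m : ℕ) := extLen_cover' (resN k V)
    ((LinearMap.range (F.d (m + 1))).liftQ (F.d m) (F.exact_succ m).ge)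
    (LinearMap.range (F.d m)).mkQ
    (by
      rw [← LinearMap.ker_eq_bot]
      exact Submodule.ker_liftQ_eq_bot _ _ _ (F.exact_succ m).le)
    (by
      rw [LinearMap.exact_iff, Submodule.ker_mkQ, Submodule.range_liftQ])
    (Submodule.mkQ_surjective _)
    (by
      intro a q y
      obtain ⟨a, rfl⟩ := Submodule.Quotient.mk_surjective _ a
      exact resN_smul _ (F.minimal m a q) y)
  have shift : ∀ (l m : ℕ), extLen (ModuleCat.of (MvPolynomial V k)
      (_ ⧸ LinearMap.range (F.d m))) (resN k V) l =
      ENat.card (Σ j : ℕ, Fin (F.β (m + l) j)) := by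
    intro l
    induction l with
    | zero => exact fun m => (key m).1
    | succ l ih =>
      intro m
      rw [(key m).2 l, ih (m + 1), add_right_comm, add_assoc]
  let e : (_ ⧸ LinearMap.range (F.d 0)) ≃ₗ[MvPolynomial V k] (MvPolynomial V k ⧸ I) :=
    (Submodule.quotEquivOfEq _ _ F.exact_zero.symm).trans
      (F.aug.quotKerEquivOfSurjective F.aug_surjective)
  rw [← extLen_congr e, shift i 0, zero_add]

lemma tsum_eq_of_card (b : ℕ → ℕ) (c : ℕ) (h : ENat.card (Σ j : ℕ, Fin (b j)) = c) :
    (∑' j : ℕ, (b j : ℕ∞)) = (c : ℕ∞) := by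
  have hfin : Finite (Σ j : ℕ, Fin (b j)) := by
    rw [← ENat.card_lt_top, h]; exact ENat.coe_lt_top c
  have := Fintype.ofFinite (Σ j : ℕ, Fin (b j))
  let s : Finset ℕ := Finset.univ.image (Sigma.fst : (Σ j : ℕ, Fin (b j)) → ℕ)
  have hs : ∀ j ∉ s, b j = 0 := by
    intro j hj
    by_contra hne
    exact hj (Finset.mem_image.2 ⟨⟨j, ⟨0, Nat.pos_of_ne_zero hne⟩⟩, Finset.mem_univ _, rfl⟩)
  rw [tsum_eq_sum (s := s) (fun j hj => by simp [hs j hj]), ← h, ENat.card_eq_coe_fintype_card,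
    ← Nat.cast_sum]
  congr 1
  rw [← Finset.card_univ, Finset.card_eq_sum_card_fiberwise (f := Sigma.fst) (t := s)
    (fun x _ => Finset.mem_coe.2 (Finset.mem_image_of_mem _ (Finset.mem_univ x)))]
  refine Finset.sum_congr rfl fun j _ => ?_
  have : Finset.univ.filter (fun x : (Σ j : ℕ, Fin (b j)) => x.1 = j) =
      Finset.univ.map (Function.Embedding.sigmaMk j) := by
    ext ⟨j', t⟩
    simp only [Finset.mem_filter, Finset.mem_univ, true_and, Finset.mem_map]
    constructor
    · rintro rfl; exact ⟨t, rfl⟩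
    · rintro ⟨t', ht⟩; exact (congrArg Sigma.fst ht).symm
  rw [this, Finset.card_map, Finset.card_univ, Fintype.card_fin]

end MonomialHelpers

/-- Let `H` be a `d`-uniform hypergraph with `n` (distinct) edges
`E 0, …, E (n-1)` on vertex set `V` (every vertex lies in some edge), such that every
edge of `H` contains a free vertex (a vertex lying in at most one edge).  Then for every
`i`, the `i`-th total Betti number of `R ⧸ I(H)` over `R = k[x_v : v ∈ V]` equals the
binomial coefficient `C(n, i)`. -/
theorem totalBetti_of_freeVertex (k V : Type) [Field k] [Fintype V] [DecidableEq V]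
    (n d : ℕ) (E : Fin n → Finset V)
    (hinj : Function.Injective E)
    (huniform : ∀ i, (E i).card = d)
    (hcover : ∀ v : V, ∃ i, v ∈ E i)
    (hfree : ∀ i, ∃ v ∈ E i, ∀ i', v ∈ E i' → i' = i)
    (F : MinimalGradedFreeResolution k V (edgeIdeal k E)) (i : ℕ) :
    (∑' j : ℕ, (F.β i j : ℕ∞)) = (n.choose i : ℕ∞) := by
  apply tsum_eq_of_card
  rw [← extLen_resolution F i]
  have hI : edgeIdeal k E = famIdeal k Finset.univ E := by
    simp [edgeIdeal, famIdeal]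
  rw [hI, extLen_fam]
  · simp
  · intro a _
    obtain ⟨v, hv, h⟩ := hfree a
    exact ⟨v, hv, fun i' _ => h i'⟩
end

section
/- Let H be a d-uniform hypergraph with n edges E_1,...,E_n such that every edge of H contains a free vertex. Then for all i and j, the graded Betti number beta_{i,j}(R/I(H)) equals the number of i-element subsets {E_{l_1},...,E_{l_i}} of the edge set whose union E_{l_1} ∪ ... ∪ E_{l_i} has cardinality j. -/
open MvPolynomial

/-! ### Abstract graded free resolutions and comparison -/

/-- Graded free resolution of `R ⧸ I` with arbitrary index types for the bases. -/
structure GRes (k V : Type) [Field k] [Fintype V] [DecidableEq V]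
    (I : Ideal (MvPolynomial V k)) where
  ι : ℕ → Type
  deg : ∀ i, ι i → ℕ
  fin : ∀ i j, Finite {p : ι i // deg i p = j}
  d : ∀ i : ℕ, (ι (i + 1) →₀ MvPolynomial V k) →ₗ[MvPolynomial V k] (ι i →₀ MvPolynomial V k)
  o : ι 0
  o_uniq : ∀ p, p = o
  o_deg : deg 0 o = 0
  range_zero : ∀ x, x ∈ LinearMap.range (d 0) ↔ x o ∈ I
  exact_succ : ∀ i, LinearMap.ker (d i) = LinearMap.range (d (i + 1))
  minimal : ∀ i x p, constantCoeff ((d i x) p) = 0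
  graded : ∀ i q p m, coeff m ((d i (Finsupp.single q 1)) p) ≠ 0 →
    m.degree + deg i p = deg (i + 1) q

section comparison

set_option linter.unusedSectionVars false

variable {k V : Type} [Field k] [Fintype V] [DecidableEq V]

/-- homogeneous element of a graded free module -/
def IsHomEl {α : Type} (δ : α → ℕ) (N : ℕ) (x : α →₀ MvPolynomial V k) : Prop :=
  ∀ p m, coeff m (x p) ≠ 0 → m.degree + δ p = N

/-- graded linear map of degree zero -/
def IsGrMap {α γ : Type} (δ : α → ℕ) (ε : γ → ℕ)
    (f : (α →₀ MvPolynomial V k) →ₗ[MvPolynomial V k] (γ →₀ MvPolynomial V k)) : Prop :=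
  ∀ q, IsHomEl ε (δ q) (f (Finsupp.single q 1))

lemma linmap_apply {α γ : Type}
    (f : (α →₀ MvPolynomial V k) →ₗ[MvPolynomial V k] (γ →₀ MvPolynomial V k))
    (x : α →₀ MvPolynomial V k) (p : γ) :
    f x p = ∑ q ∈ x.support, x q * (f (Finsupp.single q 1)) p := by
  conv_lhs => rw [← Finsupp.sum_single x, Finsupp.sum, map_sum, Finsupp.finsetSum_apply]
  refine Finset.sum_congr rfl fun q _ => ?_
  have : Finsupp.single q (x q) = x q • Finsupp.single q (1 : MvPolynomial V k) := by simp
  rw [this, map_smul, Finsupp.smul_apply, smul_eq_mul]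

lemma isHomEl_map {α γ : Type} {δ : α → ℕ} {ε : γ → ℕ}
    {f : (α →₀ MvPolynomial V k) →ₗ[MvPolynomial V k] (γ →₀ MvPolynomial V k)}
    (hf : IsGrMap δ ε f) {N : ℕ} {x : α →₀ MvPolynomial V k} (hx : IsHomEl δ N x) :
    IsHomEl ε N (f x) := by
  intro p m hm
  rw [linmap_apply, coeff_sum] at hm
  obtain ⟨q, _, hq⟩ := Finset.exists_ne_zero_of_sum_ne_zero hm
  rw [coeff_mul] at hq
  obtain ⟨⟨m1, m2⟩, h12, hne⟩ := Finset.exists_ne_zero_of_sum_ne_zero hq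
  rw [Finset.HasAntidiagonal.mem_antidiagonal] at h12
  have h1 := hx q m1 (left_ne_zero_of_mul hne)
  have h2 := hf q p m2 (right_ne_zero_of_mul hne)
  simp only at h12
  rw [← h12, map_add]
  omega

/-- degree `N` component -/
noncomputable def homPart {α : Type} (δ : α → ℕ) (N : ℕ) (x : α →₀ MvPolynomial V k) :
    α →₀ MvPolynomial V k :=
  Finsupp.onFinset x.support
    (fun p => if δ p ≤ N then homogeneousComponent (N - δ p) (x p) else 0) (by
      intro p hp
      rw [Finsupp.mem_support_iff]
      intro h
      simp [h] at hp)

lemma coeff_homPart {α : Type} (δ : α → ℕ) (N : ℕ) (x : α →₀ MvPolynomial V k) (p : α)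
    (m : V →₀ ℕ) :
    coeff m (homPart δ N x p) = if m.degree + δ p = N then coeff m (x p) else 0 := by
  rw [homPart, Finsupp.onFinset_apply]
  split_ifs with h1 h2 h2
  · rw [coeff_homogeneousComponent, if_pos (by omega)]
  · rw [coeff_homogeneousComponent, if_neg (by omega)]
  · omega
  · simp

lemma map_homPart {α γ : Type} {δ : α → ℕ} {ε : γ → ℕ}
    {f : (α →₀ MvPolynomial V k) →ₗ[MvPolynomial V k] (γ →₀ MvPolynomial V k)}
    (hf : IsGrMap δ ε f) {N : ℕ} (x : α →₀ MvPolynomial V k) (hx : IsHomEl ε N (f x)) :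
    f (homPart δ N x) = f x := by
  have hhom : IsHomEl δ N (homPart δ N x) := by
    intro p m hm
    rw [coeff_homPart] at hm
    by_contra h
    simp [h] at hm
  ext p m
  by_cases hN : m.degree + ε p = N
  · rw [linmap_apply, linmap_apply, coeff_sum, coeff_sum]
    have hsub : (homPart δ N x).support ⊆ x.support := Finsupp.support_onFinset_subset
    rw [Finset.sum_subset hsub]
    · refine Finset.sum_congr rfl fun q _ => ?_
      rw [coeff_mul, coeff_mul]
      refine Finset.sum_congr rfl fun ⟨m1, m2⟩ h12 => ?_
      rw [Finset.HasAntidiagonal.mem_antidiagonal] at h12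
      simp only at h12 ⊢
      by_cases h0 : coeff m2 ((f (Finsupp.single q 1)) p) = 0
      · rw [h0, mul_zero, mul_zero]
      · have h2 := hf q p m2 h0
        rw [← h12, map_add] at hN
        rw [coeff_homPart, if_pos (by omega)]
    · intro q _ hq
      rw [Finsupp.notMem_support_iff] at hq
      simp [hq]
  · have h1 := mt (isHomEl_map hf hhom p m) hN
    have h2 := mt (hx p m) hN
    push Not at h1 h2
    rw [h1, h2]

/-- lifting a linear map through generators -/
lemma exists_lift {α : Type} {M N : Type} [AddCommGroup M] [Module (MvPolynomial V k) M]
    [AddCommGroup N] [Module (MvPolynomial V k) N]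
    (f : (α →₀ MvPolynomial V k) →ₗ[MvPolynomial V k] N)
    (g : M →ₗ[MvPolynomial V k] N)
    (h : ∀ q, f (Finsupp.single q 1) ∈ LinearMap.range g) :
    ∃ l : (α →₀ MvPolynomial V k) →ₗ[MvPolynomial V k] M, ∀ x, g (l x) = f x := by
  choose y hy using h
  refine ⟨Finsupp.linearCombination _ y, fun x => ?_⟩
  have : g ∘ₗ Finsupp.linearCombination _ y = f := by
    ext q : 2
    simp [hy]
  exact LinearMap.congr_fun this x

lemma exists_graded_lift {α γ κ : Type} {δ : α → ℕ} {ε : γ → ℕ} {η : κ → ℕ}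
    (f : (α →₀ MvPolynomial V k) →ₗ[MvPolynomial V k] (κ →₀ MvPolynomial V k))
    (g : (γ →₀ MvPolynomial V k) →ₗ[MvPolynomial V k] (κ →₀ MvPolynomial V k))
    (hf : IsGrMap δ η f) (hg : IsGrMap ε η g)
    (h : ∀ q, f (Finsupp.single q 1) ∈ LinearMap.range g) :
    ∃ l : (α →₀ MvPolynomial V k) →ₗ[MvPolynomial V k] (γ →₀ MvPolynomial V k),
      IsGrMap δ ε l ∧ ∀ x, g (l x) = f x := by
  choose y hy using h
  refine ⟨Finsupp.linearCombination _ (fun q => homPart ε (δ q) (y q)), ?_, fun x => ?_⟩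
  · intro q p m hm
    simp only [Finsupp.linearCombination_single, one_smul] at hm
    rw [coeff_homPart] at hm
    by_contra h
    simp [h] at hm
  · have : g ∘ₗ Finsupp.linearCombination _ (fun q => homPart ε (δ q) (y q)) = f := by
      ext q : 2
      simp only [LinearMap.coe_comp, Function.comp_apply, Finsupp.lsingle_apply,
        Finsupp.linearCombination_single, one_smul]
      rw [map_homPart hg, hy]
      rw [hy]
      exact hf q
    exact LinearMap.congr_fun this x

/-- numerical consequence of a split graded map mod `m` -/
lemma card_le_of_split {α γ : Type} (δ : α → ℕ) (ε : γ → ℕ) (j : ℕ)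
    [Finite {p // δ p = j}] [Finite {p // ε p = j}]
    (φ : (α →₀ MvPolynomial V k) →ₗ[MvPolynomial V k] (γ →₀ MvPolynomial V k))
    (ψ : (γ →₀ MvPolynomial V k) →ₗ[MvPolynomial V k] (α →₀ MvPolynomial V k))
    (hφ : IsGrMap δ ε φ)
    (h : ∀ x p, constantCoeff ((ψ (φ x) - x) p) = 0) :
    Nat.card {p // δ p = j} ≤ Nat.card {p // ε p = j} := by
  classical
  have := Fintype.ofFinite {p // δ p = j}
  have := Fintype.ofFinite {p // ε p = j}
  let A : Matrix {p // ε p = j} {p // δ p = j} k :=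
    fun q p => constantCoeff (φ (Finsupp.single p.1 1) q.1)
  let B : Matrix {p // δ p = j} {p // ε p = j} k :=
    fun p q => constantCoeff (ψ (Finsupp.single q.1 1) p.1)
  have hBA : B * A = 1 := by
    ext p p'
    rw [Matrix.mul_apply]
    have h1 := h (Finsupp.single p'.1 1) p.1
    rw [Finsupp.sub_apply, map_sub, sub_eq_zero, linmap_apply, map_sum] at h1
    have h2 : constantCoeff ((Finsupp.single p'.1 (1 : MvPolynomial V k)) p.1)
        = (1 : Matrix {p // δ p = j} {p // δ p = j} k) p p' := by
      rw [Finsupp.single_apply, Matrix.one_apply]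
      by_cases hp : p = p'
      · simp [hp]
      · have : ¬ p'.1 = p.1 := fun h => hp (Subtype.ext h.symm)
        simp [hp, this]
    rw [← h2, ← h1]
    set y := φ (Finsupp.single p'.1 1) with hy
    have h3 : ∀ q, ε q ≠ j → constantCoeff (y q) = 0 := by
      intro q hq
      by_contra hne
      rw [constantCoeff_eq] at hne
      have := hφ p'.1 q 0 hne
      rw [p'.2] at this
      simp at this
      exact hq this
    have h4 : ∑ q : {q // ε q = j}, B p q * A q p' =
        ∑ q ∈ Finset.univ.image (Subtype.val : {q // ε q = j} → γ),
          constantCoeff (y q * (ψ (Finsupp.single q 1)) p.1) := by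
      rw [Finset.sum_image (fun a _ b _ h => Subtype.ext h)]
      refine Finset.sum_congr rfl fun q _ => ?_
      rw [map_mul, mul_comm]
    rw [h4]
    have h5 : ∀ q, q ∉ y.support → constantCoeff (y q * (ψ (Finsupp.single q 1)) p.1) = 0 := by
      intro q hq
      rw [Finsupp.notMem_support_iff] at hq
      simp [hq]
    have h6 : ∀ q, q ∉ Finset.univ.image (Subtype.val : {q // ε q = j} → γ) →
        constantCoeff (y q * (ψ (Finsupp.single q 1)) p.1) = 0 := by
      intro q hq
      rw [map_mul, h3, zero_mul]
      intro hq'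
      exact hq (Finset.mem_image.2 ⟨⟨q, hq'⟩, Finset.mem_univ _, rfl⟩)
    rw [Finset.sum_subset Finset.subset_union_left (fun q _ hq => h6 q hq)]
    rw [Finset.sum_subset Finset.subset_union_right (fun q _ hq => h5 q hq)]
  rw [Nat.card_eq_fintype_card, Nat.card_eq_fintype_card]
  calc Fintype.card {p // δ p = j} = (B * A).rank := by rw [hBA, Matrix.rank_one]
    _ ≤ A.rank := Matrix.rank_mul_le_right B A
    _ ≤ _ := Matrix.rank_le_card_height A

lemma constantCoeff_map {α γ : Type}
    (f : (α →₀ MvPolynomial V k) →ₗ[MvPolynomial V k] (γ →₀ MvPolynomial V k))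
    (x : α →₀ MvPolynomial V k) (hx : ∀ q, constantCoeff (x q) = 0) (p : γ) :
    constantCoeff (f x p) = 0 := by
  rw [linmap_apply, map_sum]
  refine Finset.sum_eq_zero fun q _ => ?_
  rw [map_mul, hx, zero_mul]

lemma gres_exact {I : Ideal (MvPolynomial V k)} (F : GRes k V I) (i : ℕ)
    (x : F.ι (i + 2) →₀ MvPolynomial V k) : F.d i (F.d (i + 1) x) = 0 := by
  have : F.d (i + 1) x ∈ LinearMap.ker (F.d i) := by
    rw [F.exact_succ]; exact ⟨x, rfl⟩
  exact this

lemma comparison_step {I : Ideal (MvPolynomial V k)} (F G : GRes k V I) (i : ℕ) :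
    ∃ (φ : (F.ι i →₀ MvPolynomial V k) →ₗ[MvPolynomial V k] (G.ι i →₀ MvPolynomial V k))
      (ψ : (G.ι i →₀ MvPolynomial V k) →ₗ[MvPolynomial V k] (F.ι i →₀ MvPolynomial V k))
      (h : (F.ι i →₀ MvPolynomial V k) →ₗ[MvPolynomial V k] (F.ι (i + 1) →₀ MvPolynomial V k)),
      IsGrMap (F.deg i) (G.deg i) φ ∧
      (∀ x, φ (F.d i x) ∈ LinearMap.range (G.d i)) ∧
      (∀ x, ψ (G.d i x) ∈ LinearMap.range (F.d i)) ∧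
      (∀ x, ψ (φ (F.d i x)) - F.d i x = F.d i (h (F.d i x))) ∧
      (∀ x p, constantCoeff ((ψ (φ x) - x) p) = 0) := by
  induction i with
  | zero =>
    have key : ∀ (A B : GRes k V I) (x : A.ι 0 →₀ MvPolynomial V k),
        Finsupp.lmapDomain (MvPolynomial V k) (MvPolynomial V k) (fun _ => B.o) x
          = Finsupp.single B.o (x A.o) := by
      intro A B x
      have : x = Finsupp.single A.o (x A.o) := by
        ext p : 1
        rw [A.o_uniq p, Finsupp.single_eq_same]
      rw [this]
      simp [Finsupp.lmapDomain_apply, Finsupp.mapDomain_single]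
    have hone : ∀ (A B : GRes k V I) (x : A.ι 0 →₀ MvPolynomial V k),
        Finsupp.lmapDomain (MvPolynomial V k) (MvPolynomial V k) (fun _ => A.o)
        (Finsupp.lmapDomain (MvPolynomial V k) (MvPolynomial V k) (fun _ => B.o) x) = x := by
      intro A B x
      rw [key, key]
      ext p : 1
      rw [A.o_uniq p, Finsupp.single_eq_same, Finsupp.single_eq_same]
    refine ⟨Finsupp.lmapDomain _ _ (fun _ => G.o), Finsupp.lmapDomain _ _ (fun _ => F.o), 0,
      ?_, ?_, ?_, ?_, ?_⟩
    · intro q p m hm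
      rw [F.o_uniq q, key, G.o_uniq p, Finsupp.single_eq_same, Finsupp.single_eq_same,
        coeff_one] at hm
      rw [F.o_uniq q, G.o_uniq p, F.o_deg, G.o_deg]
      have : m = 0 := by
        by_contra h
        exact hm (if_neg (Ne.symm h))
      simp [this]
    · intro x
      rw [key, G.range_zero, Finsupp.single_eq_same, ← F.range_zero]
      exact ⟨x, rfl⟩
    · intro x
      rw [key, F.range_zero, Finsupp.single_eq_same, ← G.range_zero]
      exact ⟨x, rfl⟩
    · intro x
      rw [hone]; simp
    · intro x p
      rw [hone]; simp
  | succ i ih =>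
    obtain ⟨φ, ψ, h, hgr, hφ, hψ, hh, -⟩ := ih
    have hFd : IsGrMap (F.deg (i + 1)) (F.deg i) (F.d i) := fun q p m hm => F.graded i q p m hm
    have hGd : IsGrMap (G.deg (i + 1)) (G.deg i) (G.d i) := fun q p m hm => G.graded i q p m hm
    obtain ⟨φ', hgr', hφ'⟩ := exists_graded_lift (φ ∘ₗ F.d i) (G.d i)
      (δ := F.deg (i + 1)) (ε := G.deg (i + 1)) (η := G.deg i)
      (fun q => isHomEl_map hgr (hFd q)) hGd (fun q => hφ _)
    obtain ⟨ψ', hψ'⟩ := exists_lift (ψ ∘ₗ G.d i) (F.d i) (fun q => hψ _)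
    simp only [LinearMap.comp_apply] at hφ' hψ'
    obtain ⟨h', hh'⟩ := exists_lift (ψ' ∘ₗ φ' - LinearMap.id - h ∘ₗ F.d i) (F.d (i + 1)) (by
      intro q
      rw [← F.exact_succ, LinearMap.mem_ker]
      simp only [LinearMap.sub_apply, LinearMap.comp_apply, LinearMap.id_apply, map_sub]
      rw [hψ', hφ', hh, sub_self])
    simp only [LinearMap.sub_apply, LinearMap.comp_apply, LinearMap.id_apply] at hh'
    refine ⟨φ', ψ', h', hgr', ?_, ?_, ?_, ?_⟩
    · intro x
      rw [← G.exact_succ, LinearMap.mem_ker, hφ', gres_exact, map_zero]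
    · intro x
      rw [← F.exact_succ, LinearMap.mem_ker, hψ', gres_exact, map_zero]
    · intro x
      rw [hh', gres_exact, map_zero, sub_zero]
    · intro x p
      have h1 : ψ' (φ' x) - x = h (F.d i x) + F.d (i + 1) (h' x) := by
        rw [hh']; abel
      rw [h1, Finsupp.add_apply, map_add, F.minimal, add_zero]
      exact constantCoeff_map h _ (fun q => F.minimal i x q) p

lemma gres_card_le {I : Ideal (MvPolynomial V k)} (F G : GRes k V I) (i j : ℕ) :
    Nat.card {p // F.deg i p = j} ≤ Nat.card {p // G.deg i p = j} := by
  obtain ⟨φ, ψ, h, hgr, -, -, -, hc⟩ := comparison_step F G i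
  have := F.fin i j
  have := G.fin i j
  exact card_le_of_split _ _ j φ ψ hgr hc

end comparison

/-! ### The given resolution as a `GRes` -/

lemma beta_zero_unique {k V : Type} [Field k] [Fintype V]
    [DecidableEq V] {I : Ideal (MvPolynomial V k)} (F : MinimalGradedFreeResolution k V I)
    (p : Σ j : ℕ, Fin (F.β 0 j)) : p = ⟨0, ⟨0, by rw [F.β_zero]; simp⟩⟩ := by
  obtain ⟨j, t⟩ := p
  have ht := lt_of_lt_of_eq t.2 (F.β_zero j)
  by_cases hj : j = 0
  · subst hj
    rw [if_pos rfl] at ht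
    congr 1
    ext
    simp
    omega
  · rw [if_neg hj] at ht
    omega

/-- the given minimal resolution in the abstract form -/
noncomputable def MinimalGradedFreeResolution.toGRes {k V : Type} [Field k] [Fintype V]
    [DecidableEq V] {I : Ideal (MvPolynomial V k)} (F : MinimalGradedFreeResolution k V I) :
    GRes k V I where
  ι i := Σ j : ℕ, Fin (F.β i j)
  deg i p := p.1
  fin i j := by
    refine Finite.of_injective
      (fun p : {p : Σ j : ℕ, Fin (F.β i j) // p.1 = j} => (p.2 ▸ p.1.2 : Fin (F.β i j))) ?_
    rintro ⟨⟨a, s⟩, rfl⟩ ⟨⟨b, t⟩, hb⟩ h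
    simp only at hb
    subst hb
    simp only at h
    rw [h]
  d := F.d
  o := ⟨0, ⟨0, by rw [F.β_zero]; simp⟩⟩
  o_uniq := beta_zero_unique F
  o_deg := rfl
  range_zero := by
    have hu := beta_zero_unique F
    intro x
    rw [← F.exact_zero, LinearMap.mem_ker]
    generalize (⟨0, ⟨0, by rw [F.β_zero]; simp⟩⟩ : (Σ j : ℕ, Fin (F.β 0 j))) = o at hu ⊢
    have hx : ∀ x, F.aug x = x o • F.aug (Finsupp.single o 1) := by
      intro x
      rw [← map_smul, Finsupp.smul_single, smul_eq_mul, mul_one]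
      congr 1
      ext p : 1
      rw [hu p, Finsupp.single_eq_same]
    obtain ⟨y, hy⟩ := F.aug_surjective 1
    rw [hx] at hy
    rw [hx x]
    obtain ⟨w, hw⟩ := Ideal.Quotient.mk_surjective (F.aug (Finsupp.single o 1))
    rw [← hw] at hy ⊢
    have hy' : Ideal.Quotient.mk I (y o * w) = Ideal.Quotient.mk I 1 := hy
    have hiff : x o • Ideal.Quotient.mk I w = 0 ↔ x o * w ∈ I :=
      Ideal.Quotient.eq_zero_iff_mem (I := I) (a := x o * w)
    rw [hiff]
    rw [Ideal.Quotient.eq] at hy'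
    constructor
    · intro h
      have : x o = y o * (x o * w) - x o * (y o * w - 1) := by ring
      rw [this]
      exact I.sub_mem (I.mul_mem_left _ h) (I.mul_mem_left _ hy')
    · exact fun h => I.mul_mem_right _ h
  exact_succ := F.exact_succ
  minimal := F.minimal
  graded := by
    rintro i ⟨j, t⟩ p m hm
    obtain ⟨h1, h2⟩ := F.graded i j t p
    rcases h2 with h2 | h2
    · have := h1 hm
      have h3 : m.degree = Finsupp.weight (1 : V → ℕ) m :=
        DFunLike.congr_fun (Finsupp.degree_eq_weight_one (R := ℕ)) m
      rw [← h3] at this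
      simp only at this ⊢
      omega
    · rw [h2] at hm
      simp at hm

/-! ### The Taylor complex -/

section taylor

set_option linter.unusedSectionVars false

variable (k : Type) {V : Type} [Field k] [Fintype V] [DecidableEq V] {n : ℕ}
  (E : Fin n → Finset V)

/-- exponent vector of a squarefree monomial -/
noncomputable def expo (A : Finset V) : V →₀ ℕ := Finsupp.indicator A (fun _ _ => 1)

lemma expo_apply (A : Finset V) (v : V) : expo A v = if v ∈ A then 1 else 0 := by
  simp [expo, Finsupp.indicator_apply]

lemma expo_le_iff (A : Finset V) (a : V →₀ ℕ) : expo A ≤ a ↔ ∀ v ∈ A, 1 ≤ a v := by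
  rw [Finsupp.le_def]
  constructor
  · intro h v hv
    have := h v
    rwa [expo_apply, if_pos hv] at this
  · intro h v
    rw [expo_apply]
    split_ifs with hv
    · exact h v hv
    · exact Nat.zero_le _

lemma expo_mono {A B : Finset V} (h : A ⊆ B) : expo A ≤ expo B := by
  rw [expo_le_iff]
  intro v hv
  rw [expo_apply, if_pos (h hv)]

lemma degree_expo (A : Finset V) : (expo A).degree = A.card := by
  rw [Finsupp.degree_eq_sum]
  simp [expo_apply]

lemma monomial_expo (A : Finset V) :
    monomial (expo A) (1 : k) = ∏ v ∈ A, (X v : MvPolynomial V k) := by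
  rw [monomial_eq, C_1, one_mul, Finsupp.prod_fintype _ _ (by simp)]
  simp only [expo_apply]
  rw [← Finset.prod_subset (Finset.subset_univ A)]
  · refine Finset.prod_congr rfl fun v hv => ?_
    simp [hv]
  · intro v _ hv
    simp [hv]

/-- exponent vector of the lcm -/
noncomputable def lc (S : Finset (Fin n)) : V →₀ ℕ := expo (S.biUnion E)

lemma lc_mono {S T : Finset (Fin n)} (h : S ⊆ T) : lc E S ≤ lc E T :=
  expo_mono (Finset.biUnion_subset_biUnion_of_subset_left _ h)

/-- edges dividing `x^a` -/
noncomputable def dv (a : V →₀ ℕ) : Finset (Fin n) :=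
  Finset.univ.filter fun i => ∀ v ∈ E i, 1 ≤ a v

lemma lc_le_iff (S : Finset (Fin n)) (a : V →₀ ℕ) : lc E S ≤ a ↔ S ⊆ dv E a := by
  rw [lc, expo_le_iff]
  simp only [Finset.mem_biUnion, Finset.subset_iff, dv, Finset.mem_filter, Finset.mem_univ,
    true_and]
  constructor
  · intro h i hi v hv
    exact h v ⟨i, hi, hv⟩
  · rintro h v ⟨i, hi, hv⟩
    exact h hi v hv

/-- the sign -/
def sg (S : Finset (Fin n)) (s : Fin n) : k := (-1) ^ (S.filter (· < s)).card

/-- total Taylor differential -/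
noncomputable def tD : (Finset (Fin n) →₀ MvPolynomial V k) →ₗ[MvPolynomial V k]
    (Finset (Fin n) →₀ MvPolynomial V k) :=
  Finsupp.linearCombination _ fun S => ∑ s ∈ S,
    Finsupp.single (S.erase s) (monomial (lc E S - lc E (S.erase s)) (sg k S s))

/-- basis element of multidegree `a` -/
noncomputable def bs (a : V →₀ ℕ) (S : Finset (Fin n)) : Finset (Fin n) →₀ MvPolynomial V k :=
  Finsupp.single S (monomial (a - lc E S) 1)

lemma tD_single (S : Finset (Fin n)) : tD k E (Finsupp.single S 1) = ∑ s ∈ S,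
    Finsupp.single (S.erase s) (monomial (lc E S - lc E (S.erase s)) (sg k S s)) := by
  simp [tD]

lemma tD_bs (a : V →₀ ℕ) (S : Finset (Fin n)) (h : S ⊆ dv E a) :
    tD k E (bs k E a S) = ∑ s ∈ S, sg k S s • bs k E a (S.erase s) := by
  rw [tD, bs, Finsupp.linearCombination_single, Finset.smul_sum]
  refine Finset.sum_congr rfl fun s hs => ?_
  rw [bs, Finsupp.smul_single, Finsupp.smul_single, smul_eq_mul, monomial_mul, one_mul,
    smul_monomial, smul_eq_mul, mul_one]
  congr 1
  rw [tsub_add_tsub_cancel ((lc_le_iff E S a).2 h) (lc_mono E (Finset.erase_subset s S))]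

/-- the contracting homotopy, `k`-linear -/
noncomputable def tH : (Finset (Fin n) →₀ MvPolynomial V k) →ₗ[k]
    (Finset (Fin n) →₀ MvPolynomial V k) :=
  Finsupp.lsum k fun S => (basisMonomials V k).constr k fun b =>
    if h : (dv E (b + lc E S)).Nonempty then
      if (dv E (b + lc E S)).min' h ∈ S then 0
      else bs k E (b + lc E S) (insert ((dv E (b + lc E S)).min' h) S)
    else 0

lemma tH_bs (a : V →₀ ℕ) (S : Finset (Fin n)) (h : S ⊆ dv E a) (hne : (dv E a).Nonempty) :
    tH k E (bs k E a S) = if (dv E a).min' hne ∈ S then 0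
      else bs k E a (insert ((dv E a).min' hne) S) := by
  rw [bs, tH, Finsupp.lsum_single]
  have h1 : (monomial (a - lc E S) (1 : k)) = basisMonomials V k (a - lc E S) := by
    simp [coe_basisMonomials]
  rw [h1, Module.Basis.constr_basis]
  have h2 : a - lc E S + lc E S = a := tsub_add_cancel_of_le ((lc_le_iff E S a).2 h)
  rw [h2, dif_pos hne]

lemma sg_min (S : Finset (Fin n)) (e : Fin n) (h : ∀ s ∈ S, e ≤ s) : sg k S e = 1 := by
  rw [sg, Finset.filter_eq_empty_iff.2]
  · simp
  · intro s hs
    exact not_lt.2 (h s hs)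

lemma sg_insert (S : Finset (Fin n)) (e s : Fin n) (he : e ∉ S) (hs : e < s) :
    sg k (insert e S) s = - sg k S s := by
  rw [sg, sg, Finset.filter_insert, if_pos hs, Finset.card_insert_of_notMem (by simp [he]),
    pow_succ, mul_neg_one]

lemma homotopy_bs (a : V →₀ ℕ) (S : Finset (Fin n)) (h : S ⊆ dv E a) (hne : (dv E a).Nonempty) :
    tD k E (tH k E (bs k E a S)) + tH k E (tD k E (bs k E a S)) = bs k E a S := by
  have hsub : ∀ s, S.erase s ⊆ dv E a := fun s => (Finset.erase_subset s S).trans h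
  rw [tD_bs k E a S h, map_sum]
  simp only [map_smul]
  simp only [fun s => tH_bs k E a (S.erase s) (hsub s) hne]
  rw [tH_bs k E a S h hne]
  have hmin : ∀ s ∈ S, (dv E a).min' hne ≤ s := fun s hs => Finset.min'_le _ _ (h hs)
  have hmem : (dv E a).min' hne ∈ dv E a := Finset.min'_mem _ _
  generalize (dv E a).min' hne = e at hmin hmem ⊢
  by_cases he : e ∈ S
  · rw [if_pos he, map_zero, zero_add, Finset.sum_eq_single_of_mem e he]
    · rw [if_neg (Finset.notMem_erase e S), Finset.insert_erase he, sg_min k S e hmin, one_smul]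
    · intro s _ hse
      rw [if_pos (Finset.mem_erase.2 ⟨hse.symm, he⟩), smul_zero]
  · rw [if_neg he, tD_bs k E a _ (Finset.insert_subset hmem h), Finset.sum_insert he,
      Finset.erase_insert he, sg_min k (insert e S) e, one_smul, add_assoc,
      ← Finset.sum_add_distrib, Finset.sum_eq_zero, add_zero]
    · intro s hs
      have hes : e ≠ s := fun h => he (h ▸ hs)
      rw [if_neg (fun h => he (Finset.mem_of_mem_erase h)),
        sg_insert k S e s he (lt_of_le_of_ne (hmin s hs) hes),
        Finset.erase_insert_of_ne hes, neg_smul, neg_add_cancel]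
    · intro s hs
      rcases Finset.mem_insert.1 hs with rfl | hs
      · exact le_rfl
      · exact hmin s hs

lemma sg_swap (S : Finset (Fin n)) (s t : Fin n) (hs : s ∈ S) (hst : s < t) :
    sg k S s * sg k (S.erase s) t + sg k S t * sg k (S.erase t) s = 0 := by
  have h1 : sg k (S.erase t) s = sg k S s := by
    rw [sg, sg, Finset.filter_erase, Finset.erase_eq_of_notMem]
    simp [hst.le]
  have h2 : sg k S t = - sg k (S.erase s) t := by
    conv_lhs => rw [← Finset.insert_erase hs]
    exact sg_insert k _ s t (Finset.notMem_erase s S) hst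
  rw [h1, h2]
  ring

lemma tD_tD_bs (a : V →₀ ℕ) (S : Finset (Fin n)) (h : S ⊆ dv E a) :
    tD k E (tD k E (bs k E a S)) = 0 := by
  have hsub : ∀ s, S.erase s ⊆ dv E a := fun s => (Finset.erase_subset s S).trans h
  have hs : ∀ (c : k) x, tD k E (c • x) = c • tD k E x := by
    intro c x
    rw [← algebraMap_smul (MvPolynomial V k) c x, map_smul, algebraMap_smul]
  rw [tD_bs k E a S h, map_sum]
  simp only [hs, fun s => tD_bs k E a (S.erase s) (hsub s), Finset.smul_sum, smul_smul]
  rw [Finset.sum_sigma']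
  refine Finset.sum_involution (fun x _ => ⟨x.2, x.1⟩) ?_ ?_ ?_ ?_
  · rintro ⟨s, t⟩ hx
    simp only [Finset.mem_sigma, Finset.mem_erase] at hx ⊢
    obtain ⟨hs, hts, ht⟩ := hx
    rw [Finset.erase_right_comm (a := t) (b := s), ← add_smul]
    rcases lt_or_gt_of_ne hts with hlt | hlt
    · rw [add_comm, sg_swap k S t s ht hlt, zero_smul]
    · rw [sg_swap k S s t hs hlt, zero_smul]
  · rintro ⟨s, t⟩ hx _ heq
    simp only [Finset.mem_sigma, Finset.mem_erase] at hx
    simp only [Sigma.mk.injEq, heq_eq_eq] at heq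
    exact hx.2.1 heq.1
  · rintro ⟨s, t⟩ hx
    simp only [Finset.mem_sigma, Finset.mem_erase] at hx ⊢
    exact ⟨hx.2.2, Ne.symm hx.2.1, hx.1⟩
  · rintro ⟨s, t⟩ hx
    rfl

lemma tD_tD (x : Finset (Fin n) →₀ MvPolynomial V k) : tD k E (tD k E x) = 0 := by
  have : tD k E ∘ₗ tD k E = 0 := by
    ext S : 2
    have h1 := tD_tD_bs k E (lc E S) S ((lc_le_iff E S _).1 le_rfl)
    rw [bs, tsub_self, monomial_zero', C_1] at h1
    simpa using h1
  exact LinearMap.congr_fun this x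

/-- inclusion of a level -/
noncomputable def tI (i : ℕ) : ({S : Finset (Fin n) // S.card = i} →₀ MvPolynomial V k)
    →ₗ[MvPolynomial V k] (Finset (Fin n) →₀ MvPolynomial V k) :=
  Finsupp.lmapDomain _ _ Subtype.val

lemma tI_single (i : ℕ) (S : {S : Finset (Fin n) // S.card = i}) (r : MvPolynomial V k) :
    tI k i (Finsupp.single S r) = Finsupp.single S.1 r := by
  simp [tI, Finsupp.mapDomain_single]

lemma tI_inj (i : ℕ) : Function.Injective (tI (V := V) (n := n) k i) :=
  Finsupp.mapDomain_injective Subtype.val_injective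

/-- levelwise Taylor differential -/
noncomputable def td (i : ℕ) : ({S : Finset (Fin n) // S.card = i + 1} →₀ MvPolynomial V k)
    →ₗ[MvPolynomial V k] ({S : Finset (Fin n) // S.card = i} →₀ MvPolynomial V k) :=
  Finsupp.linearCombination _ fun S => ∑ s ∈ S.1.attach,
    Finsupp.single ⟨S.1.erase s.1, by rw [Finset.card_erase_of_mem s.2, S.2]; rfl⟩
      (monomial (lc E S.1 - lc E (S.1.erase s.1)) (sg k S.1 s.1))

lemma td_single (i : ℕ) (S : {S : Finset (Fin n) // S.card = i + 1}) :
    td k E i (Finsupp.single S 1) = ∑ s ∈ S.1.attach,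
    Finsupp.single ⟨S.1.erase s.1, by rw [Finset.card_erase_of_mem s.2, S.2]; rfl⟩
      (monomial (lc E S.1 - lc E (S.1.erase s.1)) (sg k S.1 s.1)) := by
  simp [td]

lemma tI_td (i : ℕ) (x : {S : Finset (Fin n) // S.card = i + 1} →₀ MvPolynomial V k) :
    tI k i (td k E i x) = tD k E (tI k (i + 1) x) := by
  have : tI k i ∘ₗ td k E i = tD k E ∘ₗ tI k (i + 1) := by
    ext S : 2
    simp only [LinearMap.comp_apply, Finsupp.lsingle_apply]
    rw [td_single, tI_single, tD_single, map_sum, ← Finset.sum_attach S.1]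
    refine Finset.sum_congr rfl fun s _ => ?_
    rw [tI_single]
  exact LinearMap.congr_fun this x

lemma single_eq_bs (S : Finset (Fin n)) (b : V →₀ ℕ) (c : k) :
    Finsupp.single S (monomial b c) = c • bs k E (b + lc E S) S := by
  rw [bs, add_tsub_cancel_right, Finsupp.smul_single, smul_monomial, smul_eq_mul, mul_one]

/-- induction on elements of a level -/
lemma level_induction (i : ℕ)
    {P : ({S : Finset (Fin n) // S.card = i} →₀ MvPolynomial V k) → Prop}
    (h0 : P 0) (hadd : ∀ x y, P x → P y → P (x + y))
    (hs : ∀ S b c, P (Finsupp.single S (monomial b c))) (x) : P x := by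
  induction x using Finsupp.induction_linear with
  | zero => exact h0
  | add x y hx hy => exact hadd x y hx hy
  | single S r =>
    induction r using MvPolynomial.monomial_add_induction_on with
    | C a => exact hs S 0 a
    | monomial_add a b f _ _ hf =>
      rw [Finsupp.single_add]
      exact hadd _ _ (hs S a b) hf

lemma homotopy_level (i : ℕ) (x : {S : Finset (Fin n) // S.card = i + 1} →₀ MvPolynomial V k) :
    tD k E (tH k E (tI k _ x)) + tH k E (tD k E (tI k _ x)) = tI k _ x := by
  induction x using level_induction with
  | h0 => simp
  | hadd x y hx hy =>
    simp only [map_add]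
    conv_rhs => rw [← hx, ← hy]
    abel
  | hs S b c =>
    have hsub : S.1 ⊆ dv E (b + lc E S.1) := (lc_le_iff E _ _).1 le_add_self
    have hne : S.1.Nonempty := Finset.card_pos.1 (by rw [S.2]; omega)
    have hs : ∀ (c : k) x, tD k E (c • x) = c • tD k E x := by
      intro c x
      rw [← algebraMap_smul (MvPolynomial V k) c x, map_smul, algebraMap_smul]
    rw [tI_single, single_eq_bs k E]
    simp only [hs, map_smul]
    rw [← smul_add, homotopy_bs k E _ _ hsub (hne.mono hsub)]

lemma tH_level (i : ℕ) (x : {S : Finset (Fin n) // S.card = i + 1} →₀ MvPolynomial V k) :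
    ∃ y, tI k (i + 2) y = tH k E (tI k _ x) := by
  induction x using level_induction with
  | h0 => exact ⟨0, by simp⟩
  | hadd x y hx hy =>
    obtain ⟨a, ha⟩ := hx
    obtain ⟨b, hb⟩ := hy
    exact ⟨a + b, by simp only [map_add, ha, hb]⟩
  | hs S b c =>
    have hsub : S.1 ⊆ dv E (b + lc E S.1) := (lc_le_iff E _ _).1 le_add_self
    have hne : S.1.Nonempty := Finset.card_pos.1 (by rw [S.2]; omega)
    rw [tI_single, single_eq_bs k E, map_smul, tH_bs k E _ _ hsub (hne.mono hsub)]
    split_ifs with h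
    · exact ⟨0, by simp⟩
    · refine ⟨Finsupp.single ⟨insert _ S.1, by rw [Finset.card_insert_of_notMem h, S.2]⟩
        (c • monomial (b + lc E S.1 - lc E (insert ((dv E (b + lc E S.1)).min' (hne.mono hsub)) S.1)) 1), ?_⟩
      rw [tI_single, bs, Finsupp.smul_single]

lemma td_exact (i : ℕ) : LinearMap.ker (td k E i) = LinearMap.range (td k E (i + 1)) := by
  ext x
  rw [LinearMap.mem_ker, LinearMap.mem_range]
  constructor
  · intro hx
    obtain ⟨y, hy⟩ := tH_level k E i x
    refine ⟨y, tI_inj k _ ?_⟩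
    rw [tI_td, hy]
    have h1 := homotopy_level k E i x
    rwa [← tI_td, hx, map_zero, map_zero, add_zero] at h1
  · rintro ⟨y, rfl⟩
    apply tI_inj k
    rw [tI_td, tI_td, tD_tD, map_zero]

lemma td_zero_single (S : {S : Finset (Fin n) // S.card = 0 + 1}) (e : Fin n) (he : S.1 = {e}) :
    td k E 0 (Finsupp.single S 1) = Finsupp.single ⟨∅, rfl⟩ (∏ v ∈ E e, (X v)) := by
  apply tI_inj k
  rw [tI_td, tI_single, tI_single, tD_single, he, Finset.sum_singleton, sg_min, ← monomial_expo]
  · have h0 : lc E ({e} : Finset (Fin n)) - lc E (({e} : Finset (Fin n)).erase e)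
        = expo (E e) := by
      ext v
      simp [lc, expo_apply]
    rw [h0, Finset.erase_singleton]
  · simp

lemma td_range_zero (x : {S : Finset (Fin n) // S.card = 0} →₀ MvPolynomial V k) :
    x ∈ LinearMap.range (td k E 0) ↔ x ⟨∅, rfl⟩ ∈ edgeIdeal k E := by
  constructor
  · rintro ⟨y, rfl⟩
    rw [linmap_apply]
    refine Ideal.sum_mem _ fun S _ => Ideal.mul_mem_left _ _ ?_
    obtain ⟨e, he⟩ := Finset.card_eq_one.1 S.2
    rw [td_zero_single k E S e he, Finsupp.single_eq_same]
    exact Ideal.subset_span ⟨e, rfl⟩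
  · intro hx
    have hx' : x = Finsupp.single ⟨∅, rfl⟩ (x ⟨∅, rfl⟩) := by
      ext ⟨p, hp⟩ : 1
      obtain rfl := Finset.card_eq_zero.1 hp
      rw [Finsupp.single_eq_same]
    rw [hx']
    generalize x ⟨∅, rfl⟩ = r at hx
    rw [edgeIdeal] at hx
    induction hx using Submodule.span_induction with
    | mem r hr =>
      obtain ⟨e, rfl⟩ := hr
      exact ⟨_, td_zero_single k E ⟨{e}, rfl⟩ e rfl⟩
    | zero => simp
    | add a b _ _ ha hb => rw [Finsupp.single_add]; exact Submodule.add_mem _ ha hb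
    | smul a b _ hb =>
      rw [← Finsupp.smul_single]; exact Submodule.smul_mem _ _ hb

lemma td_coeff (i : ℕ) (S : {S : Finset (Fin n) // S.card = i + 1})
    (T : {S : Finset (Fin n) // S.card = i}) (m : V →₀ ℕ)
    (h : coeff m (td k E i (Finsupp.single S 1) T) ≠ 0) :
    ∃ s ∈ S.1, T.1 = S.1.erase s ∧ m = lc E S.1 - lc E (S.1.erase s) := by
  classical
  rw [td_single, Finsupp.finsetSum_apply, coeff_sum] at h
  obtain ⟨s, _, hs⟩ := Finset.exists_ne_zero_of_sum_ne_zero h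
  rw [Finsupp.single_apply] at hs
  split_ifs at hs with h1
  · rw [coeff_monomial] at hs
    split_ifs at hs with h2
    · exact ⟨s.1, s.2, by rw [← h1], h2.symm⟩
    · exact absurd rfl hs
  · simp at hs

/-- the Taylor resolution -/
noncomputable def taylor (hfree : ∀ i, ∃ v ∈ E i, ∀ i', v ∈ E i' → i' = i) :
    GRes k V (edgeIdeal k E) where
  ι i := {S : Finset (Fin n) // S.card = i}
  deg i S := (S.1.biUnion E).card
  fin i j := inferInstance
  d := td k E
  o := ⟨∅, rfl⟩
  o_uniq := by
    rintro ⟨p, hp⟩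
    obtain rfl := Finset.card_eq_zero.1 hp
    rfl
  o_deg := by simp
  range_zero := td_range_zero k E
  exact_succ := td_exact k E
  minimal := by
    intro i x p
    rw [linmap_apply, map_sum]
    refine Finset.sum_eq_zero fun S _ => ?_
    rw [map_mul]
    convert mul_zero _
    by_contra hne
    rw [constantCoeff_eq] at hne
    obtain ⟨s, hs, _, h0⟩ := td_coeff k E i S p 0 hne
    obtain ⟨v, hv, hv'⟩ := hfree s
    have h1 := DFunLike.congr_fun h0 v
    rw [Finsupp.tsub_apply, lc, lc, expo_apply, expo_apply, if_pos, if_neg] at h1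
    · simp at h1
    · simp only [Finset.mem_biUnion, Finset.mem_erase, not_exists, not_and]
      intro t ht hvt
      exact ht.1 (hv' t hvt)
    · exact Finset.mem_biUnion.2 ⟨s, hs, hv⟩
  graded := by
    intro i S T m hm
    obtain ⟨s, hs, hT, rfl⟩ := td_coeff k E i S T m hm
    have h1 := tsub_add_cancel_of_le (lc_mono E (Finset.erase_subset s S.1))
    have h2 := congrArg Finsupp.degree h1
    rw [map_add] at h2
    rw [hT]
    rw [lc, lc, degree_expo, degree_expo] at h2
    exact h2

end taylor

/-- Let `H` be a `d`-uniform hypergraph with `n` (distinct) edges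
`E 0, …, E (n-1)` on vertex set `V` (every vertex lies in some edge), such that every
edge of `H` contains a free vertex.  Then for all `i` and `j`, the graded Betti number
`β_{i,j}(R ⧸ I(H))` equals the number of `i`-element subsets of the edge set whose
union has cardinality `j`. -/
theorem gradedBetti_of_freeVertex (k V : Type) [Field k] [Fintype V] [DecidableEq V]
    (n d : ℕ) (E : Fin n → Finset V)
    (hinj : Function.Injective E)
    (huniform : ∀ i, (E i).card = d)
    (hcover : ∀ v : V, ∃ i, v ∈ E i)
    (hfree : ∀ i, ∃ v ∈ E i, ∀ i', v ∈ E i' → i' = i)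
    (F : MinimalGradedFreeResolution k V (edgeIdeal k E)) (i j : ℕ) :
    F.β i j =
      (((Finset.univ : Finset (Fin n)).powersetCard i).filter
        (fun S => (S.biUnion E).card = j)).card := by
  have h : Nat.card {p // F.toGRes.deg i p = j} = Nat.card {p // (taylor k E hfree).deg i p = j} :=
    le_antisymm (gres_card_le _ _ i j) (gres_card_le _ _ i j)
  have h1 : Nat.card {p // F.toGRes.deg i p = j} = F.β i j := by
    change Nat.card {p : (Σ j : ℕ, Fin (F.β i j)) // p.1 = j} = _
    rw [Nat.card_congr (Equiv.sigmaSubtype (β := fun j => Fin (F.β i j)) j), Nat.card_fin]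
  have h2 : Nat.card {p // (taylor k E hfree).deg i p = j} =
      (((Finset.univ : Finset (Fin n)).powersetCard i).filter
        (fun S => (S.biUnion E).card = j)).card := by
    change Nat.card {p : {S : Finset (Fin n) // S.card = i} // (p.1.biUnion E).card = j} = _
    rw [Nat.card_congr (Equiv.subtypeSubtypeEquivSubtypeInter (fun S : Finset (Fin n) => S.card = i)
      (fun S => (S.biUnion E).card = j)), Nat.card_eq_fintype_card]
    rw [Fintype.card_of_subtype]
    intro S
    simp [Finset.mem_powersetCard]
  rw [← h1, h, h2]
end
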